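/- For every nonzero ξ ∈ S, the subspace K_ξ = {x ∈ V : ρ(x)(ξ) = 0} is totally isotropic with respect to g; in particular, dim K_ξ ≤ m. -/

import Mathlib

noncomputable section

open scoped TensorProduct

/-- The `(2m+1)`-dimensional space `V := N × N* × ℂ`. -/
abbrev Vsp (N : Type) [AddCommGroup N] [Module ℂ N] : Type := N × (N →ₗ[ℂ] ℂ) × ℂ

/-- The bilinear map `B((v,φ,t),(v',φ',t')) = φ(v') − t·t'`, whose diagonal is `Q`. -/
def Bform (N : Type) [AddCommGroup N] [Module ℂ N] : Vsp N →ₗ[ℂ] Vsp N →ₗ[ℂ] ℂ :=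
  LinearMap.mk₂ ℂ (fun x y => x.2.1 y.1 - x.2.2 * y.2.2)
    (fun x x' y => by simp only [Prod.fst_add, Prod.snd_add, LinearMap.add_apply]; ring)
    (fun c x y => by
      simp only [Prod.smul_fst, Prod.smul_snd, LinearMap.smul_apply, smul_eq_mul]; ring)
    (fun x y y' => by simp only [Prod.fst_add, Prod.snd_add, map_add]; ring)
    (fun c x y => by simp only [Prod.smul_fst, Prod.smul_snd, map_smul, smul_eq_mul]; ring)

/-- The quadratic form `Q(v, φ, t) := φ(v) − t²`. -/
def Qform (N : Type) [AddCommGroup N] [Module ℂ N] : QuadraticForm ℂ (Vsp N) :=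
  LinearMap.BilinMap.toQuadraticMap (Bform N)

/-- The polar form `g(x,y) := (Q(x+y) − Q(x) − Q(y))/2`. -/
def gform (N : Type) [AddCommGroup N] [Module ℂ N] (x y : Vsp N) : ℂ :=
  (Qform N (x + y) - Qform N x - Qform N y) / 2

/-- `σ` : the involution acting on `⋀^k N` as `(−1)^(m−k)`. -/
def sigmaMap (m : ℕ) (N : Type) [AddCommGroup N] [Module ℂ N] :
    ExteriorAlgebra ℂ N →ₗ[ℂ] ExteriorAlgebra ℂ N :=
  ((-1 : ℂ) ^ m) • (CliffordAlgebra.involute (Q := (0 : QuadraticForm ℂ N))).toLinearMap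

/-- `ρ(v, φ, t)(ξ) := v ∧ ξ − ι_φ(ξ) + t·σ(ξ)`. -/
def rho (m : ℕ) (N : Type) [AddCommGroup N] [Module ℂ N] :
    Vsp N →ₗ[ℂ] ExteriorAlgebra ℂ N →ₗ[ℂ] ExteriorAlgebra ℂ N :=
  (LinearMap.mul ℂ (ExteriorAlgebra ℂ N) ∘ₗ ExteriorAlgebra.ι ℂ ∘ₗ
      LinearMap.fst ℂ N ((N →ₗ[ℂ] ℂ) × ℂ))
  - (CliffordAlgebra.contractLeft (Q := (0 : QuadraticForm ℂ N)) ∘ₗ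
      LinearMap.fst ℂ (N →ₗ[ℂ] ℂ) ℂ ∘ₗ LinearMap.snd ℂ N ((N →ₗ[ℂ] ℂ) × ℂ))
  + (LinearMap.toSpanSingleton ℂ (ExteriorAlgebra ℂ N →ₗ[ℂ] ExteriorAlgebra ℂ N)
        (sigmaMap m N) ∘ₗ
      LinearMap.snd ℂ (N →ₗ[ℂ] ℂ) ℂ ∘ₗ LinearMap.snd ℂ N ((N →ₗ[ℂ] ℂ) × ℂ))

/-- `K_ξ := {x ∈ V : ρ(x)(ξ) = 0}`. -/
def Kker (m : ℕ) (N : Type) [AddCommGroup N] [Module ℂ N] (ξ : ExteriorAlgebra ℂ N) :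
    Submodule ℂ (Vsp N) :=
  LinearMap.ker ((rho m N).flip ξ)

namespace CliffordAlgebra

variable {R M : Type*} [CommRing R] [AddCommGroup M] [Module R M] {Q : QuadraticForm R M}

theorem contractLeft_involute (d : Module.Dual R M) (a : CliffordAlgebra Q) :
    contractLeft d (involute a) = -involute (contractLeft d a) := by
  induction a using CliffordAlgebra.left_induction with
  | algebraMap r => simp
  | add a b ha hb => simp only [map_add, ha, hb, neg_add]
  | ι_mul a v ha =>
    simp only [map_mul, involute_ι, neg_mul, map_neg, contractLeft_ι_mul, map_sub, map_smul, ha]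
    simp

end CliffordAlgebra

theorem Qform_apply (N : Type) [AddCommGroup N] [Module ℂ N] (x : Vsp N) :
    Qform N x = x.2.1 x.1 - x.2.2 * x.2.2 :=
  rfl

theorem rho_apply (m : ℕ) (N : Type) [AddCommGroup N] [Module ℂ N] (x : Vsp N)
    (ξ : ExteriorAlgebra ℂ N) :
    rho m N x ξ = ExteriorAlgebra.ι ℂ x.1 * ξ - CliffordAlgebra.contractLeft x.2.1 ξ
      + x.2.2 • (-1 : ℂ) ^ m • CliffordAlgebra.involute ξ :=
  rfl

/-- The Clifford relation `ρ(x)² = -Q(x)`. -/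
theorem rho_rho (m : ℕ) (N : Type) [AddCommGroup N] [Module ℂ N] (x : Vsp N)
    (ξ : ExteriorAlgebra ℂ N) : rho m N x (rho m N x ξ) = -(Qform N x • ξ) := by
  have hsq : ((-1 : ℂ) ^ m) * (-1) ^ m = 1 := by rw [← mul_pow]; simp
  have hι : ExteriorAlgebra.ι ℂ x.1 * (ExteriorAlgebra.ι ℂ x.1 * ξ) = 0 := by
    rw [← mul_assoc, ExteriorAlgebra.ι_sq_zero, zero_mul]
  have hcontract : CliffordAlgebra.contractLeft x.2.1 (ExteriorAlgebra.ι ℂ x.1 * ξ) =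
      x.2.1 x.1 • ξ - ExteriorAlgebra.ι ℂ x.1 * CliffordAlgebra.contractLeft x.2.1 ξ :=
    CliffordAlgebra.contractLeft_ι_mul _ _ _
  have hinvolute : CliffordAlgebra.involute (ExteriorAlgebra.ι ℂ x.1 * ξ) =
      -(ExteriorAlgebra.ι ℂ x.1 * CliffordAlgebra.involute ξ) := by
    rw [map_mul, CliffordAlgebra.involute_ι, neg_mul]
  simp only [rho_apply, Qform_apply, map_add, map_sub, map_smul, hι, hcontract,
    hinvolute, CliffordAlgebra.contractLeft_contractLeft, CliffordAlgebra.contractLeft_involute,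
    CliffordAlgebra.involute_involute]
  linear_combination (norm := module) congrArg (fun c : ℂ => (x.2.2 * x.2.2 * c) • ξ) hsq

theorem Qform_eq_zero_of_mem_Kker {m : ℕ} {N : Type} [AddCommGroup N] [Module ℂ N]
    {ξ : ExteriorAlgebra ℂ N} (hξ : ξ ≠ 0) {x : Vsp N} (hx : x ∈ Kker m N ξ) :
    Qform N x = 0 := by
  have hx' : rho m N x ξ = 0 := hx
  have h := rho_rho m N x ξ
  rw [hx', map_zero, eq_comm, neg_eq_zero] at h
  exact (smul_eq_zero.mp h).resolve_right hξ

theorem gform_eq_zero_of_mem_Kker {m : ℕ} {N : Type} [AddCommGroup N] [Module ℂ N]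
    {ξ : ExteriorAlgebra ℂ N} (hξ : ξ ≠ 0) {x y : Vsp N} (hx : x ∈ Kker m N ξ)
    (hy : y ∈ Kker m N ξ) : gform N x y = 0 := by
  simp [gform, Qform_eq_zero_of_mem_Kker hξ hx, Qform_eq_zero_of_mem_Kker hξ hy,
    Qform_eq_zero_of_mem_Kker hξ (add_mem hx hy)]

theorem Bform_add_flip_apply (N : Type) [AddCommGroup N] [Module ℂ N] (x y : Vsp N) :
    (Bform N + (Bform N).flip) x y = x.2.1 y.1 + y.2.1 x.1 - 2 * (x.2.2 * y.2.2) := by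
  simp only [Bform, LinearMap.add_apply, LinearMap.flip_apply, LinearMap.mk₂_apply]
  ring

theorem Bform_add_flip_eq_two_mul_gform (N : Type) [AddCommGroup N] [Module ℂ N]
    (x y : Vsp N) : (Bform N + (Bform N).flip) x y = 2 * gform N x y := by
  rw [Bform_add_flip_apply]
  simp only [gform, Qform_apply, Prod.fst_add, Prod.snd_add,
    LinearMap.add_apply, map_add]
  ring

theorem nondegenerate_Bform_add_flip (N : Type) [AddCommGroup N] [Module ℂ N] :
    (Bform N + (Bform N).flip).Nondegenerate := by
  have hleft : (Bform N + (Bform N).flip).SeparatingLeft := by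
    rintro ⟨v, φ, t⟩ h
    simp only [Bform_add_flip_apply] at h
    refine Prod.ext ?_ (Prod.ext (LinearMap.ext fun w => ?_) ?_)
    · exact (Module.forall_dual_apply_eq_zero_iff ℂ v).mp fun ψ => by simpa using h (0, ψ, 0)
    · simpa using h (w, 0, 0)
    · simpa using h (0, 0, 1)
  refine ⟨hleft, fun y h => hleft y fun x => ?_⟩
  rw [← h x, Bform_add_flip_apply, Bform_add_flip_apply]
  ring

theorem finrank_Vsp (N : Type) [AddCommGroup N] [Module ℂ N] [FiniteDimensional ℂ N] :
    Module.finrank ℂ (Vsp N) = 2 * Module.finrank ℂ N + 1 := by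
  have hdual : Module.finrank ℂ (N →ₗ[ℂ] ℂ) = Module.finrank ℂ N := Subspace.dual_finrank_eq
  rw [Module.finrank_prod, Module.finrank_prod, hdual, Module.finrank_self]
  ring

theorem finrank_le_of_gform_eq_zero {N : Type} [AddCommGroup N] [Module ℂ N]
    [FiniteDimensional ℂ N] (W : Submodule ℂ (Vsp N))
    (hW : ∀ x ∈ W, ∀ y ∈ W, gform N x y = 0) :
    Module.finrank ℂ W ≤ Module.finrank ℂ N := by
  have hle : W ≤ LinearMap.BilinForm.orthogonal (Bform N + (Bform N).flip) W := by
    intro y hy x hx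
    change (Bform N + (Bform N).flip) x y = 0
    rw [Bform_add_flip_eq_two_mul_gform, hW x hx y hy, mul_zero]
  have h := Submodule.finrank_mono hle
  rw [LinearMap.BilinForm.finrank_orthogonal (nondegenerate_Bform_add_flip N), finrank_Vsp] at h
  omega

/-- for every nonzero spinor `ξ`, the subspace
`K_ξ = {x ∈ V : ρ(x)(ξ) = 0}` is totally isotropic for `g`, and `dim K_ξ ≤ m`. -/
theorem kernel_totally_isotropic
    (m : ℕ) (hm : 0 < m) (N : Type) [AddCommGroup N] [Module ℂ N]
    [FiniteDimensional ℂ N] (hdim : Module.finrank ℂ N = m) :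
    ∀ ξ : ExteriorAlgebra ℂ N, ξ ≠ 0 →
      (∀ x ∈ Kker m N ξ, ∀ y ∈ Kker m N ξ, gform N x y = 0) ∧
      Module.finrank ℂ (Kker m N ξ) ≤ m := by
  intro ξ hξ
  have hiso : ∀ x ∈ Kker m N ξ, ∀ y ∈ Kker m N ξ, gform N x y = 0 :=
    fun x hx y hy => gform_eq_zero_of_mem_Kker hξ hx hy
  exact ⟨hiso, hdim ▸ finrank_le_of_gform_eq_zero (Kker m N ξ) hiso⟩
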